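/- Let p ≡ 1 (mod 3) be a prime, m = (p−1)/3, and α = #{x ∈ C_1 : 1 + x ∈ C_2}. Then the product of the Gauss 3-periods satisfies η_0·η_1·η_2 = (1/3)·(p·α − m²). -/

import Mathlib

/-- The coset `C_s = g^s · C₀` (as a subset of `ZMod p`) of the subgroup `C₀` of
d-th powers of units, for `s : ZMod d`. -/
def Cset (p d : ℕ) [NeZero p] (g : (ZMod p)ˣ) (s : ZMod d) : Finset (ZMod p) :=
  Finset.univ.filter fun x : ZMod p =>
    ∃ y : (ZMod p)ˣ, x = (g : ZMod p) ^ s.val * (y : ZMod p) ^ d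

/-- The Gauss d-period `η_j = ∑_{x ∈ C_j} ζ^x`. -/
noncomputable def eta (p d : ℕ) [NeZero p] (g : (ZMod p)ˣ) (ζ : ℂ) (j : ZMod d) : ℂ :=
  ∑ x ∈ Cset p d g j, ζ ^ x.val

/-- A primitive root describes each coset through integer exponents in a residue class. -/
theorem mem_Cset_iff {p d : ℕ} [NeZero p] [NeZero d] {g : (ZMod p)ˣ}
    (hg : ∀ x : (ZMod p)ˣ, ∃ n : ℕ, g ^ n = x) {s : ZMod d} {x : ZMod p} :
    x ∈ Cset p d g s ↔ ∃ n : ℤ, (n : ZMod d) = s ∧ x = ((g ^ n : (ZMod p)ˣ) : ZMod p) := by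
  simp only [Cset, Finset.mem_filter, Finset.mem_univ, true_and]
  constructor
  · rintro ⟨y, rfl⟩
    obtain ⟨k, rfl⟩ := hg y
    refine ⟨((s.val + k * d : ℕ) : ℤ), by simp, ?_⟩
    rw [zpow_natCast, pow_add, pow_mul]
    push_cast
    rfl
  · rintro ⟨n, rfl, rfl⟩
    have h : ((n - ((n : ZMod d).val : ℤ) : ℤ) : ZMod d) = 0 := by simp
    obtain ⟨k, hk⟩ := (ZMod.intCast_zmod_eq_zero_iff_dvd _ d).1 h
    refine ⟨g ^ k, ?_⟩
    have hn : n = ((n : ZMod d).val : ℤ) + k * (d : ℤ) := by linarith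
    have hu : g ^ n = g ^ (n : ZMod d).val * (g ^ k) ^ d := by
      conv_lhs => rw [hn]
      rw [zpow_add, zpow_mul, zpow_natCast, zpow_natCast]
    rw [hu]
    push_cast
    rfl

section Cosets

variable {p d : ℕ} [NeZero p] [NeZero d] {g : (ZMod p)ˣ}

theorem mul_mem_Cset (hg : ∀ x : (ZMod p)ˣ, ∃ n : ℕ, g ^ n = x) {i j : ZMod d} {x y : ZMod p}
    (hx : x ∈ Cset p d g i) (hy : y ∈ Cset p d g j) : x * y ∈ Cset p d g (i + j) := by
  rw [mem_Cset_iff hg] at *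
  obtain ⟨a, rfl, rfl⟩ := hx
  obtain ⟨b, rfl, rfl⟩ := hy
  exact ⟨a + b, by push_cast; rfl, by rw [zpow_add, Units.val_mul]⟩

theorem exists_inv_mem_Cset (hg : ∀ x : (ZMod p)ˣ, ∃ n : ℕ, g ^ n = x) {i : ZMod d} {x : ZMod p}
    (hx : x ∈ Cset p d g i) : ∃ y ∈ Cset p d g (-i), x * y = 1 := by
  rw [mem_Cset_iff hg] at hx
  obtain ⟨a, rfl, rfl⟩ := hx
  exact ⟨((g ^ (-a) : (ZMod p)ˣ) : ZMod p), (mem_Cset_iff hg).2 ⟨-a, by push_cast; rfl, rfl⟩,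
    by rw [← Units.val_mul, ← zpow_add]; simp⟩

theorem mul_mem_Cset_iff (hg : ∀ x : (ZMod p)ˣ, ∃ n : ℕ, g ^ n = x) {i j : ZMod d} {x y : ZMod p}
    (hx : x ∈ Cset p d g i) : x * y ∈ Cset p d g (i + j) ↔ y ∈ Cset p d g j := by
  refine ⟨fun h => ?_, mul_mem_Cset hg hx⟩
  obtain ⟨z, hz, hxz⟩ := exists_inv_mem_Cset hg hx
  have h' := mul_mem_Cset hg hz h
  rwa [neg_add_cancel_left, ← mul_assoc, mul_comm z x, hxz, one_mul] at h'

/-- Multiplication by an element of `C_i` maps `C_j` bijectively onto `C_(i+j)`. -/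
theorem sum_Cset_mul {M : Type*} [AddCommMonoid M] (hg : ∀ x : (ZMod p)ˣ, ∃ n : ℕ, g ^ n = x)
    {i : ZMod d} (j : ZMod d) {t : ZMod p} (ht : t ∈ Cset p d g i) (f : ZMod p → M) :
    ∑ x ∈ Cset p d g j, f (t * x) = ∑ y ∈ Cset p d g (i + j), f y := by
  obtain ⟨z, -, hz⟩ := exists_inv_mem_Cset hg ht
  have hzt (x : ZMod p) : z * (t * x) = x := by rw [← mul_assoc, mul_comm z, hz, one_mul]
  have htz (x : ZMod p) : t * (z * x) = x := by rw [← mul_assoc, hz, one_mul]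
  refine Finset.sum_nbij' (t * ·) (z * ·) (fun x hx => mul_mem_Cset hg ht hx) (fun y hy => ?_)
    (fun x _ => hzt x) (fun y _ => htz y) (fun _ _ => rfl)
  exact (mul_mem_Cset_iff hg ht).1 (by rwa [htz])

theorem card_Cset_eq (hg : ∀ x : (ZMod p)ˣ, ∃ n : ℕ, g ^ n = x) (i : ZMod d) :
    (Cset p d g i).card = (Cset p d g 0).card := by
  have hi : ((g ^ (i.val : ℤ) : (ZMod p)ˣ) : ZMod p) ∈ Cset p d g i :=
    (mem_Cset_iff hg).2 ⟨i.val, by simp, rfl⟩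
  simpa [Finset.card_eq_sum_ones, -Finset.sum_const] using
    (sum_Cset_mul hg 0 hi (fun _ => 1)).symm

theorem neg_mem_Cset_iff (hg : ∀ x : (ZMod p)ˣ, ∃ n : ℕ, g ^ n = x) (hd : Odd d) {i : ZMod d}
    {x : ZMod p} : -x ∈ Cset p d g i ↔ x ∈ Cset p d g i := by
  have h : (-1 : ZMod p) ∈ Cset p d g 0 := by
    simp only [Cset, Finset.mem_filter, Finset.mem_univ, true_and]
    exact ⟨-1, by simp [hd.neg_one_pow]⟩
  simpa using mul_mem_Cset_iff hg (j := i) (y := x) h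

end Cosets

section Prime

variable {p d : ℕ} [Fact p.Prime] [NeZero d] {g : (ZMod p)ˣ}

theorem orderOf_eq_of_forall_pow (hg : ∀ x : (ZMod p)ˣ, ∃ n : ℕ, g ^ n = x) :
    orderOf g = p - 1 := by
  rw [orderOf_eq_card_of_forall_mem_zpowers, Nat.card_eq_fintype_card, ZMod.card_units]
  intro x
  obtain ⟨n, rfl⟩ := hg x
  exact Subgroup.npow_mem_zpowers g n

theorem exists_mem_Cset (hg : ∀ x : (ZMod p)ˣ, ∃ n : ℕ, g ^ n = x) {x : ZMod p} (hx : x ≠ 0) :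
    ∃ i : ZMod d, x ∈ Cset p d g i := by
  obtain ⟨n, hn⟩ := hg (Units.mk0 x hx)
  exact ⟨n, (mem_Cset_iff hg).2 ⟨n, by simp, by rw [zpow_natCast, hn, Units.val_mk0]⟩⟩

theorem ne_zero_of_mem_Cset (hg : ∀ x : (ZMod p)ˣ, ∃ n : ℕ, g ^ n = x) {x : ZMod p} {i : ZMod d}
    (hx : x ∈ Cset p d g i) : x ≠ 0 := by
  obtain ⟨n, -, rfl⟩ := (mem_Cset_iff hg).1 hx
  exact Units.ne_zero _

theorem Cset_index_unique (hg : ∀ x : (ZMod p)ˣ, ∃ n : ℕ, g ^ n = x) (hd : d ∣ p - 1)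
    {x : ZMod p} {i j : ZMod d} (hi : x ∈ Cset p d g i) (hj : x ∈ Cset p d g j) : i = j := by
  obtain ⟨a, rfl, rfl⟩ := (mem_Cset_iff hg).1 hi
  obtain ⟨b, rfl, hab⟩ := (mem_Cset_iff hg).1 hj
  have h := zpow_eq_zpow_iff_modEq.1 (Units.ext hab)
  rw [orderOf_eq_of_forall_pow hg] at h
  exact (ZMod.intCast_eq_intCast_iff a b d).2 (h.of_dvd (Int.natCast_dvd_natCast.2 hd))

/-- The cosets partition the nonzero residues into classes of equal size. -/
theorem mul_card_Cset (hg : ∀ x : (ZMod p)ˣ, ∃ n : ℕ, g ^ n = x) (hd : d ∣ p - 1) (i : ZMod d) :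
    d * (Cset p d g i).card = p - 1 := by
  have hU : (Finset.univ : Finset (ZMod d)).biUnion (Cset p d g) = Finset.univ.erase 0 := by
    ext x
    simp only [Finset.mem_biUnion, Finset.mem_univ, true_and, Finset.mem_erase, and_true]
    exact ⟨fun ⟨_, h⟩ => ne_zero_of_mem_Cset hg h, exists_mem_Cset hg⟩
  have hc := congrArg Finset.card hU
  rw [Finset.card_biUnion fun i _ j _ hij => Finset.disjoint_left.2 fun x hi hj =>
      hij (Cset_index_unique hg hd hi hj), Finset.card_erase_of_mem (Finset.mem_univ _),
    Finset.sum_congr rfl fun j _ => card_Cset_eq hg j, Finset.sum_const, Finset.card_univ,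
    Finset.card_univ, ZMod.card, ZMod.card, smul_eq_mul] at hc
  rw [card_Cset_eq hg, hc]

/-- The number of zero-sum triples in `C₀ × C₁ × C₂`, in terms of a cyclotomic number. -/
theorem sum_zero_sum_triples (hg : ∀ x : (ZMod p)ˣ, ∃ n : ℕ, g ^ n = x) :
    ∑ a ∈ Cset p 3 g 0, ∑ b ∈ Cset p 3 g 1, ∑ c ∈ Cset p 3 g 2,
      (if a + b + c = 0 then 1 else 0 : ℂ) =
    (Cset p 3 g 0).card * ((Cset p 3 g 1).filter fun x => 1 + x ∈ Cset p 3 g 2).card := by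
  rw [← nsmul_eq_mul, ← Finset.sum_const]
  refine Finset.sum_congr rfl fun a ha => ?_
  have hb := sum_Cset_mul hg 1 ha fun b => ∑ c ∈ Cset p 3 g 2, (if a + b + c = 0 then 1 else 0 : ℂ)
  rw [zero_add] at hb
  rw [← hb, Finset.card_filter, Nat.cast_sum]
  refine Finset.sum_congr rfl fun x _ => ?_
  have hc (c : ZMod p) : a + a * x + c = 0 ↔ c = -(a * (1 + x)) := by
    rw [add_eq_zero_iff_neg_eq, eq_comm, mul_add, mul_one]
  have hmem : -(a * (1 + x)) ∈ Cset p 3 g 2 ↔ 1 + x ∈ Cset p 3 g 2 := by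
    rw [neg_mem_Cset_iff hg (by decide)]
    simpa using mul_mem_Cset_iff hg (j := 2) (y := 1 + x) ha
  simp only [hc, Finset.sum_ite_eq', hmem]
  push_cast
  rfl

end Prime

/-- for a prime p ≡ 1 (mod 3), m = (p−1)/3 and
α = #{x ∈ C₁ : 1 + x ∈ C₂}, the product of the Gauss 3-periods is
η₀·η₁·η₂ = (1/3)·(p·α − m²). -/
theorem cubic_period_product (p m : ℕ) [Fact p.Prime] (hp3 : p % 3 = 1)
    (hm : p - 1 = 3 * m)
    (g : (ZMod p)ˣ) (hg : ∀ x : (ZMod p)ˣ, ∃ n : ℕ, g ^ n = x)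
    (ζ : ℂ) (hζ : IsPrimitiveRoot ζ p)
    (α : ℕ)
    (hα : α = ((Cset p 3 g 1).filter fun x => 1 + x ∈ Cset p 3 g 2).card) :
    eta p 3 g ζ 0 * eta p 3 g ζ 1 * eta p 3 g ζ 2
      = (1 / 3 : ℂ) * ((p : ℂ) * (α : ℂ) - (m : ℂ) ^ 2) := by
  have hd : 3 ∣ p - 1 := ⟨m, hm⟩
  have hcard (i : ZMod 3) : (Cset p 3 g i).card = m := by
    have := mul_card_Cset hg hd i
    omega
  have hm0 : (m : ℂ) ≠ 0 := by
    have := (Fact.out : p.Prime).two_le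
    exact_mod_cast (by omega : m ≠ 0)
  set ψ : AddChar (ZMod p) ℂ := AddChar.zmodChar p hζ.pow_eq_one with hψ
  have hprim : ψ.IsPrimitive := AddChar.zmodChar_primitive_of_primitive_root p hζ
  have heta (i : ZMod 3) : eta p 3 g ζ i = ∑ x ∈ Cset p 3 g i, ψ x := by
    simp only [eta, hψ, AddChar.zmodChar_apply]
  set E : ZMod 3 → ZMod p → ℂ := fun i t => ∑ x ∈ Cset p 3 g i, ψ (t * x) with hE
  have hEzero (i : ZMod 3) : E i 0 = m := by simp [hE, hcard]
  have hEprod {t : ZMod p} (ht : t ≠ 0) :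
      E 0 t * E 1 t * E 2 t = eta p 3 g ζ 0 * eta p 3 g ζ 1 * eta p 3 g ζ 2 := by
    obtain ⟨i, hi⟩ := exists_mem_Cset (d := 3) hg ht
    have h (j : ZMod 3) : E j t = eta p 3 g ζ (i + j) := by
      rw [heta, ← sum_Cset_mul hg j hi]
    rw [h, h, h]
    have hperm := Equiv.prod_comp (Equiv.addLeft i) (eta p 3 g ζ)
    have hthree (f : ZMod 3 → ℂ) : ∏ j, f j = f 0 * f 1 * f 2 := Fin.prod_univ_three f
    rwa [hthree, hthree] at hperm
  have hleft : ∑ t, E 0 t * E 1 t * E 2 t =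
      m ^ 3 + 3 * m * (eta p 3 g ζ 0 * eta p 3 g ζ 1 * eta p 3 g ζ 2) := by
    rw [← Finset.add_sum_erase _ _ (Finset.mem_univ 0),
      Finset.sum_congr rfl fun t ht => hEprod (Finset.ne_of_mem_erase ht), Finset.sum_const,
      Finset.card_erase_of_mem (Finset.mem_univ _), Finset.card_univ, ZMod.card, hm, hEzero,
      hEzero, hEzero, nsmul_eq_mul]
    push_cast
    ring
  have hright : ∑ t, E 0 t * E 1 t * E 2 t = p * (m * α) := by
    have hexp (t : ZMod p) : E 0 t * E 1 t * E 2 t = ∑ a ∈ Cset p 3 g 0, ∑ b ∈ Cset p 3 g 1,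
        ∑ c ∈ Cset p 3 g 2, ψ (t * (a + b + c)) := by
      simp only [hE, mul_add, AddChar.map_add_eq_mul]
      rw [Finset.sum_mul_sum, Finset.sum_mul]
      refine Finset.sum_congr rfl fun a _ => ?_
      rw [Finset.sum_mul]
      exact Finset.sum_congr rfl fun b _ => Finset.mul_sum _ _ _
    have hsum (b : ZMod p) : ∑ t, ψ (t * b) = p * (if b = 0 then 1 else 0 : ℂ) := by
      rw [AddChar.sum_mulShift b hprim, ZMod.card]
      split_ifs <;> simp
    have hN := sum_zero_sum_triples hg
    rw [hcard, ← hα] at hN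
    simp only [hexp]
    rw [Finset.sum_comm, ← hN, Finset.mul_sum]
    refine Finset.sum_congr rfl fun a _ => ?_
    rw [Finset.sum_comm, Finset.mul_sum]
    refine Finset.sum_congr rfl fun b _ => ?_
    rw [Finset.sum_comm, Finset.mul_sum]
    exact Finset.sum_congr rfl fun c _ => hsum _
  have key := hleft.symm.trans hright
  apply mul_left_cancel₀ (mul_ne_zero three_ne_zero hm0)
  linear_combination key
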